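/- arXiv:1707.07776 — 10 statements merged into one kernel-verified Lean document; each statement's English description precedes it below -/
import Mathlib

section
/- For every integer k ≥ 0, Σ_{j=1}^∞ 2/(j^k (j+1)(j+2)) = (-1)^{k-1} (2 - 3/2^k) + Σ_{j=2}^k (-1)^{k-j} (2 - 1/2^{k-j}) ζ(j). -/
/-- The Riemann zeta value `ζ(k) = Σ_{n=1}^∞ n^{-k}`. -/
noncomputable def zeta (k : ℕ) : ℝ := ∑' n : ℕ, 1 / ((n : ℝ) + 1) ^ k

open Filter Topology in
/-- A telescoping series of nonnegative terms whose partial sums are `c - g n` with `g n → 0`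
sums to `c`. -/
theorem hasSum_of_telescoping {f g : ℕ → ℝ} {c : ℝ} (hf : ∀ n, 0 ≤ f n) (h0 : g 0 = c)
    (hstep : ∀ n, f n = g n - g (n + 1)) (hg : Tendsto g atTop (𝓝 0)) : HasSum f c := by
  rw [hasSum_iff_tendsto_nat_of_nonneg hf]
  have hsum : ∀ n, ∑ i ∈ Finset.range n, f i = c - g n := fun n => by
    simp_rw [hstep, Finset.sum_range_sub', h0]
  simp_rw [hsum]
  simpa using hg.const_sub c

/-- The summand of the series, indexed from `j = 0`. -/
noncomputable def seriesTerm (k j : ℕ) : ℝ :=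
  2 / (((j : ℝ) + 1) ^ k * ((j : ℝ) + 2) * ((j : ℝ) + 3))

theorem seriesTerm_nonneg (k j : ℕ) : 0 ≤ seriesTerm k j := by
  unfold seriesTerm
  positivity

theorem tendsto_two_div_add_two :
    Filter.Tendsto (fun n : ℕ => 2 / ((n : ℝ) + 2)) Filter.atTop (nhds 0) :=
  (Filter.tendsto_atTop_add_const_right _ _ tendsto_natCast_atTop_atTop).const_div_atTop 2

theorem hasSum_seriesTerm_zero : HasSum (seriesTerm 0) 1 := by
  refine hasSum_of_telescoping (g := fun n => 2 / ((n : ℝ) + 2)) (seriesTerm_nonneg 0)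
    (by norm_num) (fun n => ?_) tendsto_two_div_add_two
  unfold seriesTerm
  push_cast
  have h : (n : ℝ) + 1 + 2 ≠ 0 := by positivity
  field_simp
  ring

theorem hasSum_seriesTerm_one : HasSum (seriesTerm 1) (1 / 2) := by
  refine hasSum_of_telescoping (g := fun n => 1 / (((n : ℝ) + 1) * ((n : ℝ) + 2)))
    (seriesTerm_nonneg 1) (by norm_num) (fun n => ?_) ?_
  · unfold seriesTerm
    push_cast
    have h : (n : ℝ) + 1 + 2 ≠ 0 := by positivity
    have h' : (n : ℝ) + 1 + 1 ≠ 0 := by positivity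
    field_simp
    ring
  · refine squeeze_zero (fun n => by positivity) (fun n => ?_) tendsto_two_div_add_two
    have hn : (0 : ℝ) ≤ n := n.cast_nonneg
    gcongr
    · norm_num
    · nlinarith

theorem summable_seriesTerm (k : ℕ) : Summable (seriesTerm k) := by
  refine hasSum_seriesTerm_zero.summable.of_nonneg_of_le (seriesTerm_nonneg k) fun j => ?_
  unfold seriesTerm
  have hj : (1 : ℝ) ≤ (j : ℝ) + 1 := by simp
  gcongr
  exact k.zero_le

theorem tsum_seriesTerm_add_two (k : ℕ) :
    ∑' j, seriesTerm (k + 2) j =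
      zeta (k + 2) - 3 / 2 * ∑' j, seriesTerm (k + 1) j - 1 / 2 * ∑' j, seriesTerm k j := by
  have hterm : ∀ j : ℕ, 1 / ((j : ℝ) + 1) ^ (k + 2) =
      seriesTerm (k + 2) j + 3 / 2 * seriesTerm (k + 1) j + 1 / 2 * seriesTerm k j := fun j => by
    unfold seriesTerm
    field_simp
    ring
  have h2 := summable_seriesTerm (k + 2)
  have h1 := (summable_seriesTerm (k + 1)).mul_left (3 / 2)
  have h0 := (summable_seriesTerm k).mul_left (1 / 2)
  rw [zeta, tsum_congr hterm, (h2.add h1).tsum_add h0, h2.tsum_add h1, tsum_mul_left,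
    tsum_mul_left]
  ring

/-- The zeta part of the closed form. -/
noncomputable def zetaPart (k : ℕ) : ℝ :=
  ∑ j ∈ Finset.Icc 2 k, (-1 : ℝ) ^ (k - j) * (2 - 1 / 2 ^ (k - j)) * zeta j

theorem zetaPart_add_two (k : ℕ) :
    zetaPart (k + 2) = zeta (k + 2) - 3 / 2 * zetaPart (k + 1) - 1 / 2 * zetaPart k := by
  unfold zetaPart
  rcases k with _ | k
  · norm_num
  have hsum : ∑ j ∈ Finset.Icc 2 (k + 1),
        (-1 : ℝ) ^ (k + 1 + 2 - j) * (2 - 1 / 2 ^ (k + 1 + 2 - j)) * zeta j =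
      -(3 / 2) * ∑ j ∈ Finset.Icc 2 (k + 1),
        (-1 : ℝ) ^ (k + 1 + 1 - j) * (2 - 1 / 2 ^ (k + 1 + 1 - j)) * zeta j -
      1 / 2 * ∑ j ∈ Finset.Icc 2 (k + 1),
        (-1 : ℝ) ^ (k + 1 - j) * (2 - 1 / 2 ^ (k + 1 - j)) * zeta j := by
    rw [Finset.mul_sum, Finset.mul_sum, ← Finset.sum_sub_distrib]
    refine Finset.sum_congr rfl fun j hj => ?_
    obtain ⟨i, hi⟩ := Nat.exists_eq_add_of_le (Finset.mem_Icc.mp hj).2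
    rw [show k + 1 + 2 - j = i + 2 by omega, show k + 1 + 1 - j = i + 1 by omega,
      show k + 1 - j = i by omega]
    simp only [pow_succ]
    field_simp
    ring
  rw [Finset.sum_Icc_succ_top (by omega : 2 ≤ k + 1 + 1 + 1),
    Finset.sum_Icc_succ_top (by omega : 2 ≤ k + 1 + 1), hsum,
    Finset.sum_Icc_succ_top (by omega : 2 ≤ k + 1 + 1),
    show k + 1 + 2 - (k + 1 + 1) = 1 by omega, show k + 1 + 2 - (k + 1 + 1 + 1) = 0 by omega,
    show k + 1 + 1 - (k + 1 + 1) = 0 by omega]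
  norm_num
  ring

theorem tsum_seriesTerm (k : ℕ) :
    ∑' j, seriesTerm k j = (-1 : ℝ) ^ (k + 1) * (2 - 3 / 2 ^ k) + zetaPart k := by
  induction k using Nat.twoStepInduction with
  | zero => rw [hasSum_seriesTerm_zero.tsum_eq]; norm_num [zetaPart]
  | one => rw [hasSum_seriesTerm_one.tsum_eq]; norm_num [zetaPart]
  | more k h0 h1 =>
    rw [tsum_seriesTerm_add_two, zetaPart_add_two, h0, h1]
    simp only [pow_succ]
    field_simp
    ring

theorem stmt1 (k : ℕ) :
    ∑' j : ℕ, 2 / (((j : ℝ) + 1) ^ k * ((j : ℝ) + 2) * ((j : ℝ) + 3)) =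
      (-1 : ℝ) ^ (k + 1) * (2 - 3 / 2 ^ k) +
        ∑ j ∈ Finset.Icc 2 k, (-1 : ℝ) ^ (k - j) * (2 - 1 / 2 ^ (k - j)) * zeta j :=
  tsum_seriesTerm k
end

section
/- For every integer k ≥ 1, the real number (-1)^{k-1} (2 - 3/2^k) + Σ_{j=2}^k (-1)^{k-j} (2 - 1/2^{k-j}) ζ(j) is strictly greater than 1/3. -/
theorem hasSum_zeta {j : ℕ} (hj : 2 ≤ j) :
    HasSum (fun n : ℕ => 1 / ((n : ℝ) + 1) ^ j) (zeta j) := by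
  have h : Summable fun n : ℕ => 1 / ((n + 1 : ℕ) : ℝ) ^ j :=
    (summable_nat_add_iff 1).2 (Real.summable_one_div_nat_pow.2 (by omega))
  push_cast at h
  exact h.hasSum

theorem hasSum_one_div_add_one_mul_add_two :
    HasSum (fun n : ℕ => 1 / (((n : ℝ) + 1) * (n + 2))) 1 := by
  rw [hasSum_iff_tendsto_nat_of_nonneg (fun n => by positivity)]
  have h (N : ℕ) : ∑ n ∈ Finset.range N, 1 / (((n : ℝ) + 1) * (n + 2)) = 1 - 1 / ((N : ℝ) + 1) := by
    induction N with
    | zero => simp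
    | succ N ih =>
      rw [Finset.sum_range_succ, ih]
      push_cast
      field_simp
      ring
  simp only [h]
  simpa using (tendsto_one_div_add_atTop_nhds_zero_nat (𝕜 := ℝ)).const_sub 1

theorem hasSum_one_div_add_one_mul_add_three :
    HasSum (fun n : ℕ => 1 / (((n : ℝ) + 1) * (n + 3))) (3 / 4) := by
  rw [hasSum_iff_tendsto_nat_of_nonneg (fun n => by positivity)]
  have h (N : ℕ) : ∑ n ∈ Finset.range N, 1 / (((n : ℝ) + 1) * (n + 3)) =
      3 / 4 - 1 / 2 * (1 / ((N : ℝ) + 1) + 1 / (((N + 1 : ℕ) : ℝ) + 1)) := by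
    induction N with
    | zero => norm_num
    | succ N ih =>
      rw [Finset.sum_range_succ, ih]
      push_cast
      field_simp
      ring
  simp only [h]
  have h₀ := tendsto_one_div_add_atTop_nhds_zero_nat (𝕜 := ℝ)
  simpa using ((h₀.add ((Filter.tendsto_add_atTop_iff_nat 1).2 h₀)).const_mul 2⁻¹).const_sub
    (3 / 4)

theorem sub_mul_sum_Icc_pow_mul_pow (x r : ℝ) (m : ℕ) :
    (x - r) * ∑ j ∈ Finset.Icc 2 (m + 1), r ^ (m + 1 - j) * x ^ j =
      x ^ (m + 2) - r ^ m * x ^ 2 := by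
  induction m with
  | zero => simp
  | succ m ih =>
    have h : ∑ j ∈ Finset.Icc 2 (m + 1), r ^ (m + 1 + 1 - j) * x ^ j =
        r * ∑ j ∈ Finset.Icc 2 (m + 1), r ^ (m + 1 - j) * x ^ j := by
      rw [Finset.mul_sum]
      refine Finset.sum_congr rfl fun j hj => ?_
      rw [Nat.succ_sub (Finset.mem_Icc.1 hj).2, pow_succ]
      ring
    rw [Finset.sum_Icc_succ_top (by omega), h, Nat.sub_self]
    linear_combination r * ih

theorem alternating_sum_add_correction {y : ℝ} (hy : 0 < y) (m : ℕ) :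
    (-1 : ℝ) ^ m * (2 * (1 / (y * (y + 1))) - 4 / 2 ^ (m + 1) * (1 / (y * (y + 2)))) +
        ∑ j ∈ Finset.Icc 2 (m + 1),
          (-1 : ℝ) ^ (m + 1 - j) * (2 - 1 / 2 ^ (m + 1 - j)) * (1 / y ^ j) =
      2 / (y ^ (m + 1) * (y + 1) * (y + 2)) := by
  have split : ∑ j ∈ Finset.Icc 2 (m + 1),
      (-1 : ℝ) ^ (m + 1 - j) * (2 - 1 / 2 ^ (m + 1 - j)) * (1 / y ^ j) =
      2 * ∑ j ∈ Finset.Icc 2 (m + 1), (-1 : ℝ) ^ (m + 1 - j) * y⁻¹ ^ j -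
        ∑ j ∈ Finset.Icc 2 (m + 1), (-1 / 2 : ℝ) ^ (m + 1 - j) * y⁻¹ ^ j := by
    rw [Finset.mul_sum, ← Finset.sum_sub_distrib]
    refine Finset.sum_congr rfl fun j _ => ?_
    rw [div_pow, inv_pow]
    ring
  have h₁ := sub_mul_sum_Icc_pow_mul_pow y⁻¹ (-1) m
  have h₂ := sub_mul_sum_Icc_pow_mul_pow y⁻¹ (-1 / 2) m
  have hy' : 0 < y⁻¹ := inv_pos.2 hy
  rw [mul_comm, ← eq_div_iff (by linarith)] at h₁ h₂
  rw [split, h₁, h₂, div_pow, inv_pow, inv_pow]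
  have e₁ : y⁻¹ - -1 = (y + 1) / y := by field_simp; ring
  have e₂ : y⁻¹ - -1 / 2 = (y + 2) / (2 * y) := by field_simp; ring
  rw [e₁, e₂]
  field_simp
  ring

theorem stmt4 (k : ℕ) (hk : 1 ≤ k) :
    1 / 3 <
      (-1 : ℝ) ^ (k + 1) * (2 - 3 / 2 ^ k) +
        ∑ j ∈ Finset.Icc 2 k, (-1 : ℝ) ^ (k - j) * (2 - 1 / 2 ^ (k - j)) * zeta j := by
  obtain ⟨m, rfl⟩ := Nat.exists_eq_add_of_le' hk
  have hsum := hasSum_sum fun j (hj : j ∈ Finset.Icc 2 (m + 1)) =>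
    (hasSum_zeta (Finset.mem_Icc.1 hj).1).mul_left
      ((-1 : ℝ) ^ (m + 1 - j) * (2 - 1 / 2 ^ (m + 1 - j)))
  have hcorr : HasSum (fun n : ℕ => (-1 : ℝ) ^ m * (2 * (1 / (((n : ℝ) + 1) * (n + 2))) -
      4 / 2 ^ (m + 1) * (1 / (((n : ℝ) + 1) * (n + 3)))))
      ((-1) ^ m * (2 * 1 - 4 / 2 ^ (m + 1) * (3 / 4))) :=
    ((hasSum_one_div_add_one_mul_add_two.mul_left 2).sub
      (hasSum_one_div_add_one_mul_add_three.mul_left (4 / 2 ^ (m + 1)))).mul_left _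
  have hterm (n : ℕ) := alternating_sum_add_correction (y := (n : ℝ) + 1) (by positivity) m
  simp only [add_assoc, one_add_one_eq_two, show (1 : ℝ) + 2 = 3 by norm_num] at hterm
  have key := hcorr.add hsum
  simp only [hterm] at key
  have hsign : (-1 : ℝ) ^ (m + 1 + 1) * (2 - 3 / 2 ^ (m + 1)) =
      (-1) ^ m * (2 * 1 - 4 / 2 ^ (m + 1) * (3 / 4)) := by ring
  rw [hsign]
  have hle := sum_le_hasSum (Finset.range 2) (fun n _ => by positivity) key
  rw [Finset.sum_range_succ, Finset.sum_range_one] at hle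
  refine lt_of_lt_of_le ?_ hle
  have hzero : (2 : ℝ) / (((0 : ℕ) + 1) ^ (m + 1) * ((0 : ℕ) + 2) * ((0 : ℕ) + 3)) = 1 / 3 := by
    norm_num
  rw [hzero]
  exact lt_add_of_pos_right _ (by positivity)
end

section
/- For every integer k ≥ 2, the multiple sum over strictly increasing (k-1)-tuples of positive integers Σ_{0 < n_1 < ⋯ < n_{k-1}} 1/((n_1+2)(n_2+2)⋯(n_{k-2}+2)(n_{k-1}+2)^2) equals Σ_{j=1}^∞ 2/(j^k (j+1)(j+2)). -/
open scoped ENNReal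

/-- Strictly increasing tuples of length `d + 1` with entries above `N` correspond to a first entry
`m > N` and a strictly increasing tuple of length `d` with entries above `m`. -/
def strictMonoTupleConsEquiv (d N : ℕ) :
    (Σ m : {m : ℕ // N < m}, {g : Fin d → ℕ // StrictMono g ∧ ∀ i, m.1 < g i}) ≃
      {f : Fin (d + 1) → ℕ // StrictMono f ∧ ∀ i, N < f i} where
  toFun p := ⟨Fin.cons p.1.1 p.2.1, by
    obtain ⟨⟨m, hm⟩, ⟨g, hg, hgm⟩⟩ := p
    refine ⟨fun a b hab => ?_, fun i => ?_⟩
    · induction a using Fin.cases with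
      | zero =>
        induction b using Fin.cases with
        | zero => exact absurd hab (lt_irrefl _)
        | succ b => simpa using hgm b
      | succ a =>
        induction b using Fin.cases with
        | zero => exact absurd hab (Fin.not_lt_zero _)
        | succ b => simpa using hg (Fin.succ_lt_succ_iff.mp hab)
    · induction i using Fin.cases with
      | zero => simpa using hm
      | succ i => simpa using hm.trans (hgm i)⟩
  invFun f := ⟨⟨f.1 0, f.2.2 0⟩, ⟨Fin.tail f.1,
    fun _ _ hab => f.2.1 (Fin.succ_lt_succ_iff.mpr hab), fun i => f.2.1 (Fin.succ_pos i)⟩⟩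
  left_inv _ := rfl
  right_inv f := Subtype.ext (Fin.cons_self_tail f.1)

/-- If `φ` is an eigenfunction of the weighted tail-sum operator, then the iterated weighted sum
over strictly increasing `d`-tuples, with `φ` applied to the last entry, is computed by the `d`-th
power of the eigenvalue. -/
theorem tsum_strictMono_prod_mul_last (w φ : ℕ → ℝ≥0∞) (c : ℝ≥0∞)
    (h : ∀ N, ∑' m : {m : ℕ // N < m}, w m * φ m = c * φ N) (d N : ℕ) :
    ∑' f : {f : Fin d → ℕ // StrictMono f ∧ ∀ i, N < f i},
      (∏ i, w (f.1 i)) * φ ((Fin.cons N f.1 : Fin (d + 1) → ℕ) (Fin.last d)) = c ^ d * φ N := by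
  induction d generalizing N with
  | zero =>
    have : Unique {f : Fin 0 → ℕ // StrictMono f ∧ ∀ i, N < f i} :=
      { default := ⟨Fin.elim0, fun a => a.elim0, fun a => a.elim0⟩
        uniq := fun f => Subtype.ext (Subsingleton.elim _ _) }
    rw [tsum_fintype, Fintype.sum_unique]
    simp
  | succ d ih =>
    rw [← (strictMonoTupleConsEquiv d N).tsum_eq, ENNReal.tsum_sigma']
    have key (m : {m : ℕ // N < m}) :
        ∑' g : {g : Fin d → ℕ // StrictMono g ∧ ∀ i, m.1 < g i},
          (∏ i, w ((strictMonoTupleConsEquiv d N ⟨m, g⟩).1 i)) *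
            φ ((Fin.cons N (strictMonoTupleConsEquiv d N ⟨m, g⟩).1 : Fin (d + 1 + 1) → ℕ)
              (Fin.last (d + 1))) = c ^ d * (w m * φ m) := by
      rw [mul_left_comm, ← ih m, ← ENNReal.tsum_mul_left]
      refine tsum_congr fun g => ?_
      rw [Fin.prod_univ_succ, mul_assoc, ← Fin.succ_last]
      rfl
    rw [tsum_congr key, ENNReal.tsum_mul_left, h, pow_succ, mul_assoc]

theorem inv_choose_sub_inv_choose_succ (n j : ℕ) :
    ((n + j).choose j : ℝ)⁻¹ - ((n + 1 + j).choose j : ℝ)⁻¹ =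
      j * (((n : ℝ) + 1)⁻¹ * ((n + 1 + j).choose j : ℝ)⁻¹) := by
  have h₁ : ((n + j).choose j : ℝ) ≠ 0 :=
    Nat.cast_ne_zero.mpr (Nat.choose_pos (Nat.le_add_left j n)).ne'
  have h₂ : ((n + 1 + j).choose j : ℝ) ≠ 0 :=
    Nat.cast_ne_zero.mpr (Nat.choose_pos (Nat.le_add_left j (n + 1))).ne'
  have h := Nat.choose_mul_succ_eq (n + j) j
  rw [show n + j + 1 - j = n + 1 by omega, show n + j + 1 = n + 1 + j by omega] at h
  have h' : ((n + j).choose j : ℝ) * (n + 1 + j) = (n + 1 + j).choose j * (n + 1) := by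
    exact_mod_cast h
  have h₃ : (n : ℝ) + 1 ≠ 0 := by positivity
  field_simp
  linear_combination -h'

theorem tendsto_inv_choose_add_atTop {j : ℕ} (hj : 0 < j) :
    Filter.Tendsto (fun n : ℕ => ((n + j).choose j : ℝ)⁻¹) Filter.atTop (nhds 0) := by
  refine Filter.Tendsto.comp tendsto_inv_atTop_zero
    (tendsto_natCast_atTop_atTop.comp (Filter.tendsto_atTop_mono (fun n => ?_) Filter.tendsto_id))
  rw [id, ← Nat.choose_symm_add]
  calc n ≤ (n + 1).choose n := by simp
    _ ≤ (n + j).choose n := Nat.choose_le_choose n (by omega)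

theorem hasSum_inv_mul_inv_choose {j : ℕ} (hj : 0 < j) (N : ℕ) :
    HasSum (fun i : ℕ => ((N + i : ℕ) + 1 : ℝ)⁻¹ * ((N + i + 1 + j).choose j : ℝ)⁻¹)
      ((j : ℝ)⁻¹ * ((N + j).choose j : ℝ)⁻¹) := by
  have hj' : (j : ℝ) ≠ 0 := by positivity
  rw [hasSum_iff_tendsto_nat_of_nonneg (fun i => by positivity)]
  have hs (n : ℕ) :
      ∑ i ∈ Finset.range n, ((N + i : ℕ) + 1 : ℝ)⁻¹ * ((N + i + 1 + j).choose j : ℝ)⁻¹ =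
        (j : ℝ)⁻¹ * (((N + j).choose j : ℝ)⁻¹ - ((N + n + j).choose j : ℝ)⁻¹) := by
    have ht := Finset.sum_range_sub' (fun i => ((N + i + j).choose j : ℝ)⁻¹) n
    simp only [add_zero] at ht
    rw [← ht, Finset.mul_sum]
    refine Finset.sum_congr rfl fun i _ => ?_
    rw [← add_assoc N i 1, inv_choose_sub_inv_choose_succ, inv_mul_cancel_left₀ hj']
  simp only [hs]
  have hl : Filter.Tendsto (fun n : ℕ => ((N + n + j).choose j : ℝ)⁻¹) Filter.atTop (nhds 0) :=
    (tendsto_inv_choose_add_atTop hj).comp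
      (Filter.tendsto_atTop_mono (fun n => Nat.le_add_left n N) Filter.tendsto_id)
  simpa using (hl.const_sub ((N + j).choose j : ℝ)⁻¹).const_mul (j : ℝ)⁻¹

theorem tsum_ofReal_inv_mul_inv_choose {j : ℕ} (hj : 0 < j) (N : ℕ) :
    ∑' i : ℕ, ENNReal.ofReal ((N + i : ℕ) + 1 : ℝ)⁻¹ *
        ENNReal.ofReal ((N + i + 1 + j).choose j : ℝ)⁻¹ =
      ENNReal.ofReal (j : ℝ)⁻¹ * ENNReal.ofReal ((N + j).choose j : ℝ)⁻¹ := by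
  have h := hasSum_inv_mul_inv_choose hj N
  rw [← ENNReal.ofReal_mul (by positivity), ← h.tsum_eq,
    ENNReal.ofReal_tsum_of_nonneg (fun i => by positivity) h.summable]
  exact tsum_congr fun i => (ENNReal.ofReal_mul (by positivity)).symm

theorem ENNReal.tsum_subtype_lt (u : ℕ → ℝ≥0∞) (N : ℕ) :
    ∑' m : {m : ℕ // N < m}, u m = ∑' i : ℕ, u (N + i + 1) := by
  let e : ℕ ≃ {m : ℕ // N < m} :=
    { toFun := fun i => ⟨N + i + 1, by omega⟩
      invFun := fun m => m.1 - N - 1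
      left_inv := fun i => by simp only; omega
      right_inv := fun m => Subtype.ext (by have := m.2; simp only; omega) }
  exact (e.tsum_eq fun m => u m).symm

/-- The inverse binomial coefficient sums to the reciprocal of its fixed index. -/
theorem ofReal_inv_eq_tsum_inv_choose {m : ℕ} (hm : 0 < m) :
    ENNReal.ofReal (m : ℝ)⁻¹ =
      ∑' j : ℕ, ENNReal.ofReal ((j : ℝ) + 1)⁻¹ *
        ENNReal.ofReal ((m + (j + 1)).choose (j + 1) : ℝ)⁻¹ := by
  have h := tsum_ofReal_inv_mul_inv_choose hm 0
  simp only [zero_add, Nat.choose_self, Nat.cast_one, inv_one, ENNReal.ofReal_one, mul_one] at h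
  rw [← h]
  refine tsum_congr fun j => ?_
  rw [add_comm m (j + 1), Nat.choose_symm_add]

theorem tsum_strictMono_prod_mul_inv_choose {j : ℕ} (hj : 0 < j) (d : ℕ) :
    ∑' f : {f : Fin (d + 1) → ℕ // StrictMono f ∧ ∀ i, 0 < f i},
      (∏ i, ENNReal.ofReal ((f.1 i : ℝ) + 2)⁻¹) *
        ENNReal.ofReal ((f.1 (Fin.last d) + 2 + j).choose j : ℝ)⁻¹ =
      ENNReal.ofReal (j : ℝ)⁻¹ ^ (d + 1) * ENNReal.ofReal ((2 + j).choose j : ℝ)⁻¹ := by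
  have h := tsum_strictMono_prod_mul_last (fun n => ENNReal.ofReal ((n : ℝ) + 2)⁻¹)
    (fun n => ENNReal.ofReal ((n + 2 + j).choose j : ℝ)⁻¹) (ENNReal.ofReal (j : ℝ)⁻¹)
    (fun N => ?_) (d + 1) 0
  · simpa only [← Fin.succ_last, Fin.cons_succ, zero_add] using h
  · rw [ENNReal.tsum_subtype_lt (fun m => ENNReal.ofReal ((m : ℝ) + 2)⁻¹ *
      ENNReal.ofReal ((m + 2 + j).choose j : ℝ)⁻¹), ← tsum_ofReal_inv_mul_inv_choose hj]
    refine tsum_congr fun i => ?_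
    rw [show N + i + 1 + 2 + j = N + 2 + i + 1 + j by omega]
    congr 3
    push_cast
    ring

theorem stmt5 (k : ℕ) (hk : 2 ≤ k) :
    (∑' f : {f : Fin (k - 1) → ℕ // StrictMono f ∧ ∀ i, 0 < f i},
        (∏ i, (1 : ℝ) / ((f.1 i : ℝ) + 2)) *
          (1 / ((f.1 ⟨k - 2, by omega⟩ : ℝ) + 2))) =
      ∑' j : ℕ, 2 / (((j : ℝ) + 1) ^ k * ((j : ℝ) + 2) * ((j : ℝ) + 3)) := by
  obtain ⟨d, rfl⟩ : ∃ d, k = d + 2 := ⟨k - 2, by omega⟩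
  change (∑' f : {f : Fin (d + 1) → ℕ // StrictMono f ∧ ∀ i, 0 < f i},
        (∏ i, (1 : ℝ) / ((f.1 i : ℝ) + 2)) * (1 / ((f.1 (Fin.last d) : ℝ) + 2))) = _
  have hl (f : {f : Fin (d + 1) → ℕ // StrictMono f ∧ ∀ i, 0 < f i}) :
      (∏ i, (1 : ℝ) / ((f.1 i : ℝ) + 2)) * (1 / ((f.1 (Fin.last d) : ℝ) + 2)) =
        ((∏ i, ENNReal.ofReal ((f.1 i : ℝ) + 2)⁻¹) *
          ENNReal.ofReal ((f.1 (Fin.last d) + 2 : ℕ) : ℝ)⁻¹).toReal := by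
    rw [← ENNReal.ofReal_prod_of_nonneg (fun i _ => by positivity),
      ← ENNReal.ofReal_mul (Finset.prod_nonneg fun i _ => by positivity),
      ENNReal.toReal_ofReal (mul_nonneg (Finset.prod_nonneg fun i _ => by positivity)
        (by positivity))]
    simp
  have hr (j : ℕ) : 2 / (((j : ℝ) + 1) ^ (d + 2) * ((j : ℝ) + 2) * ((j : ℝ) + 3)) =
      (ENNReal.ofReal ((j : ℝ) + 1)⁻¹ * (ENNReal.ofReal ((j + 1 : ℕ) : ℝ)⁻¹ ^ (d + 1) *
        ENNReal.ofReal ((2 + (j + 1)).choose (j + 1) : ℝ)⁻¹)).toReal := by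
    rw [← ENNReal.ofReal_pow (by positivity), ← ENNReal.ofReal_mul (by positivity),
      ← ENNReal.ofReal_mul (by positivity), ENNReal.toReal_ofReal (by positivity),
      ← Nat.choose_symm_add, Nat.cast_choose_two]
    push_cast
    have h₁ : (j : ℝ) + 1 ≠ 0 := by positivity
    have h₂ : (2 : ℝ) + (j + 1) - 1 = j + 2 := by ring
    have h₃ : (2 : ℝ) + (j + 1) = j + 3 := by ring
    rw [h₂, h₃, inv_pow]
    field_simp
    ring
  simp only [hl, hr]
  rw [← ENNReal.tsum_toReal_eq, ← ENNReal.tsum_toReal_eq]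
  · congr 1
    simp only [ofReal_inv_eq_tsum_inv_choose (Nat.succ_pos (_ + 1)), ← ENNReal.tsum_mul_left]
    rw [ENNReal.tsum_comm]
    refine tsum_congr fun j => ?_
    rw [← tsum_strictMono_prod_mul_inv_choose (Nat.succ_pos j) d, ← ENNReal.tsum_mul_left]
    exact tsum_congr fun f => mul_left_comm _ _ _
  · intro j
    finiteness
  · intro f
    exact ENNReal.mul_ne_top (ENNReal.prod_ne_top fun i _ => ENNReal.ofReal_ne_top)
      ENNReal.ofReal_ne_top
end

section
/- For all integers h ≥ 1 and k ≥ 1, the multiple zeta value with k-1 leading ones and last exponent h+1 equals the multiple zeta value with h-1 leading ones and last exponent k+1; that is, Σ_{0 < n_1 < ⋯ < n_k} 1/(n_1 n_2 ⋯ n_{k-1} n_k^{h+1}) = Σ_{0 < m_1 < ⋯ < m_h} 1/(m_1 m_2 ⋯ m_{h-1} m_h^{k+1}). -/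
/-- The multiple zeta value `ζ(1,…,1,h+1)` with `k` leading ones:
the sum over strictly increasing `(k+1)`-tuples of positive integers of
`1/(n_1 ⋯ n_k n_{k+1}^{h+1})`. -/
noncomputable def mzvOnes (k h : ℕ) : ℝ :=
  ∑' f : {f : Fin (k + 1) → ℕ // StrictMono f ∧ ∀ i, 0 < f i},
    (∏ i, (1 : ℝ) / (f.1 i : ℝ)) * (1 / (f.1 (Fin.last k) : ℝ)) ^ h

open scoped ENNReal Nat

namespace MzvDuality

/-- The reciprocal of a natural number in `ℝ≥0∞`, with value `0` at `0`. -/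
noncomputable def recip (n : ℕ) : ℝ≥0∞ := ENNReal.ofReal (1 / (n : ℝ))

/-- The connector `m! n! / (m + n)!`. -/
noncomputable def connector (m n : ℕ) : ℝ := (m ! : ℝ) * n ! / (m + n)!

/-- The sum of `1 / (n_1 ⋯ n_k)` over `0 < n_1 < ⋯ < n_k = n`. -/
noncomputable def chainSum : ℕ → ℕ → ℝ≥0∞
  | 0, n => if n = 0 then 1 else 0
  | k + 1, n => recip n * ∑ j ∈ Finset.range n, chainSum k j

lemma connector_nonneg (m n : ℕ) : 0 ≤ connector m n := by
  unfold connector; positivity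

lemma connector_comm (m n : ℕ) : connector m n = connector n m := by
  unfold connector; rw [mul_comm, add_comm]

lemma connector_zero_right (m : ℕ) : connector m 0 = 1 := by
  have : (m ! : ℝ) ≠ 0 := by positivity
  simp [connector, this]

lemma connector_sub_connector_succ {m : ℕ} (hm : 1 ≤ m) (n : ℕ) :
    1 / (m : ℝ) * connector m n - 1 / (m : ℝ) * connector m (n + 1) =
      1 / ((n + 1 : ℕ) : ℝ) * connector m (n + 1) := by
  have h1 : (m : ℝ) ≠ 0 := by positivity
  have h2 : ((n : ℝ) + 1) ≠ 0 := by positivity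
  have h3 : ((m + n)! : ℝ) ≠ 0 := by positivity
  have h4 : ((m : ℝ) + n + 1) ≠ 0 := by positivity
  unfold connector
  rw [← add_assoc, Nat.factorial_succ, Nat.factorial_succ]
  push_cast
  field_simp
  ring

lemma connector_le {m : ℕ} (hm : 1 ≤ m) (n : ℕ) :
    connector m n ≤ m ! * (1 / ((n : ℝ) + 1)) := by
  have h : ((n + 1)! : ℝ) ≤ (m + n)! := by
    exact_mod_cast Nat.factorial_le (by omega)
  unfold connector
  rw [mul_div_assoc]
  refine mul_le_mul_of_nonneg_left ?_ (by positivity)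
  rw [div_le_div_iff₀ (by positivity) (by positivity), one_mul]
  calc (n ! : ℝ) * (n + 1) = (n + 1)! := by rw [Nat.factorial_succ]; push_cast; ring
    _ ≤ _ := h

lemma tendsto_connector {m : ℕ} (hm : 1 ≤ m) :
    Filter.Tendsto (connector m) Filter.atTop (nhds 0) := by
  refine squeeze_zero (connector_nonneg m) (connector_le hm) ?_
  simpa using tendsto_one_div_add_atTop_nhds_zero_nat.const_mul (m ! : ℝ)

lemma hasSum_connector {m : ℕ} (hm : 1 ≤ m) (n : ℕ) :
    HasSum (fun i : ℕ => 1 / ((n + i + 1 : ℕ) : ℝ) * connector m (n + i + 1))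
      (1 / (m : ℝ) * connector m n) := by
  rw [hasSum_iff_tendsto_nat_of_nonneg
    (fun i => mul_nonneg (by positivity) (connector_nonneg _ _))]
  have h : ∀ N, ∑ i ∈ Finset.range N, 1 / ((n + i + 1 : ℕ) : ℝ) * connector m (n + i + 1) =
      1 / (m : ℝ) * connector m n - 1 / (m : ℝ) * connector m (n + N) := fun N => by
    simp_rw [← connector_sub_connector_succ hm]
    exact Finset.sum_range_sub' (fun i => 1 / (m : ℝ) * connector m (n + i)) N
  simp_rw [h]
  have := (((tendsto_connector hm).comp (Filter.tendsto_add_atTop_nat n)).const_mul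
    (1 / (m : ℝ))).const_sub (1 / (m : ℝ) * connector m n)
  simpa [Function.comp_def, add_comm] using this

lemma recip_mul_connector {m : ℕ} (hm : 1 ≤ m) (n : ℕ) :
    recip m * ENNReal.ofReal (connector m n) =
      ∑' b, if n < b then recip b * ENNReal.ofReal (connector m b) else 0 := by
  have h := hasSum_connector hm n
  have hterm : ∀ i : ℕ,
      ENNReal.ofReal (1 / ((n + i + 1 : ℕ) : ℝ) * connector m (n + i + 1)) =
        recip (i + (n + 1)) * ENNReal.ofReal (connector m (i + (n + 1))) := fun i => by
    rw [ENNReal.ofReal_mul (by positivity), show n + i + 1 = i + (n + 1) by omega, recip]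
  have hsplit := Summable.sum_add_tsum_nat_add' (k := n + 1) (f := fun b =>
    if n < b then recip b * ENNReal.ofReal (connector m b) else 0) ENNReal.summable
  rw [← hsplit, Finset.sum_eq_zero fun b hb =>
    if_neg (by have := Finset.mem_range.1 hb; omega), zero_add, recip,
    ← ENNReal.ofReal_mul (by positivity), ← h.tsum_eq,
    ENNReal.ofReal_tsum_of_nonneg
      (fun i => mul_nonneg (by positivity) (connector_nonneg _ _)) h.summable]
  refine tsum_congr fun i => ?_
  rw [hterm, if_pos (by omega)]

lemma tsum_chainSum_mul_tail (k : ℕ) (g : ℕ → ℝ≥0∞) :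
    ∑' a, chainSum k a * ∑' n, (if a < n then recip n * g n else 0) =
      ∑' n, chainSum (k + 1) n * g n := by
  simp_rw [← ENNReal.tsum_mul_left]
  rw [ENNReal.tsum_comm]
  refine tsum_congr fun n => ?_
  have hzero : ∀ a ∉ Finset.range n,
      chainSum k a * (if a < n then recip n * g n else 0) = 0 := fun a ha => by
    rw [if_neg (by simpa using ha), mul_zero]
  calc _ = ∑ a ∈ Finset.range n, chainSum k a * (if a < n then recip n * g n else 0) :=
        tsum_eq_sum hzero
    _ = ∑ a ∈ Finset.range n, chainSum k a * (recip n * g n) :=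
        Finset.sum_congr rfl fun a ha => by rw [if_pos (Finset.mem_range.1 ha)]
    _ = chainSum (k + 1) n * g n := by
        rw [chainSum, ← Finset.sum_mul]
        ring

/-- The connected sum in which the remaining exponent `h` is carried by the first variable. -/
noncomputable def connectedSum (k h s : ℕ) : ℝ≥0∞ :=
  ∑' m, chainSum k m * recip m ^ h * ∑' n, chainSum s n * ENNReal.ofReal (connector m n)

lemma connectedSum_transport (k h s : ℕ) :
    connectedSum (k + 1) (h + 1) s = connectedSum (k + 1) h (s + 1) := by
  refine tsum_congr fun m => ?_
  rcases Nat.eq_zero_or_pos m with rfl | hm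
  · simp [chainSum]
  · rw [pow_succ, mul_assoc, mul_assoc, mul_assoc, ← tsum_chainSum_mul_tail]
    simp_rw [← recip_mul_connector hm]
    rw [← ENNReal.tsum_mul_left]
    simp_rw [mul_left_comm]

lemma connectedSum_eq (k h s : ℕ) :
    connectedSum (k + 1) h s = connectedSum (k + 1) 0 (s + h) := by
  induction h generalizing s with
  | zero => rfl
  | succ h ih => rw [connectedSum_transport, ih, add_right_comm, add_assoc]

lemma connectedSum_zero_right (k h : ℕ) :
    connectedSum k h 0 = ∑' m, chainSum k m * recip m ^ h := by
  refine tsum_congr fun m => ?_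
  rw [tsum_eq_single 0 (fun n hn => by simp [chainSum, hn])]
  simp [chainSum, connector_zero_right]

lemma connectedSum_zero_comm (k s : ℕ) : connectedSum k 0 s = connectedSum s 0 k := by
  simp only [connectedSum, pow_zero, mul_one, ← ENNReal.tsum_mul_left]
  rw [ENNReal.tsum_comm]
  simp_rw [mul_left_comm, connector_comm]

lemma tsum_chainSum_duality (k h : ℕ) :
    ∑' m, chainSum (k + 1) m * recip m ^ (h + 1) =
      ∑' m, chainSum (h + 1) m * recip m ^ (k + 1) := by
  rw [← connectedSum_zero_right, ← connectedSum_zero_right, connectedSum_eq,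
    connectedSum_eq h, zero_add, zero_add, connectedSum_zero_comm]

lemma snoc_mem_iff {k : ℕ} (f : Fin (k + 1) → ℕ) (n : ℕ) :
    (StrictMono (Fin.snoc f n : Fin (k + 2) → ℕ) ∧
        ∀ i, 0 < (Fin.snoc f n : Fin (k + 2) → ℕ) i) ↔
      (StrictMono f ∧ ∀ i, 0 < f i) ∧ f (Fin.last k) < n := by
  rw [Fin.strictMono_iff_lt_succ, Fin.strictMono_iff_lt_succ, Fin.forall_fin_succ',
    Fin.forall_fin_succ' (P := fun i => 0 < (Fin.snoc f n : Fin (k + 2) → ℕ) i)]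
  simp only [Fin.snoc_castSucc, Fin.succ_last, Fin.snoc_last, ← Fin.castSucc_succ]
  constructor
  · rintro ⟨⟨h1, h2⟩, h3, h4⟩
    exact ⟨⟨h1, h3⟩, h2⟩
  · rintro ⟨⟨h1, h2⟩, h3⟩
    exact ⟨⟨h1, h3⟩, h2, by omega⟩

lemma tsum_strictMono_eq (k : ℕ) (g : ℕ → ℝ≥0∞) :
    ∑' f : {f : Fin (k + 1) → ℕ // StrictMono f ∧ ∀ i, 0 < f i},
      (∏ i, recip (f.1 i)) * g (f.1 (Fin.last k)) = ∑' n, chainSum (k + 1) n * g n := by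
  classical
  have key : ∀ (k : ℕ) (g : ℕ → ℝ≥0∞),
      ∑' f : {f : Fin (k + 1) → ℕ // StrictMono f ∧ ∀ i, 0 < f i},
        (∏ i, recip (f.1 i)) * g (f.1 (Fin.last k)) =
      ∑' f : Fin (k + 1) → ℕ, if StrictMono f ∧ ∀ i, 0 < f i then
        (∏ i, recip (f i)) * g (f (Fin.last k)) else 0 := fun k g => by
    refine (tsum_subtype {f : Fin (k + 1) → ℕ | StrictMono f ∧ ∀ i, 0 < f i}
      (fun f => (∏ i, recip (f i)) * g (f (Fin.last k)))).trans (tsum_congr fun f => ?_)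
    simp [Set.indicator_apply]
  induction k generalizing g with
  | zero =>
    rw [key, ← (Equiv.funUnique (Fin 1) ℕ).symm.tsum_eq]
    refine tsum_congr fun n => ?_
    rcases Nat.eq_zero_or_pos n with rfl | hn
    · simp [chainSum]
    · have hmono : StrictMono ((Equiv.funUnique (Fin 1) ℕ).symm n) :=
        Subsingleton.strictMono _
      rw [if_pos ⟨hmono, fun _ => hn⟩]
      simp [chainSum, hn]
  | succ k ih =>
    rw [← tsum_chainSum_mul_tail, ← ih, key (k + 1) g,
      key k (fun a => ∑' n, if a < n then recip n * g n else 0),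
      ← (Fin.snocEquiv (fun _ : Fin (k + 2) => ℕ)).tsum_eq, ENNReal.tsum_prod',
      ENNReal.tsum_comm]
    refine tsum_congr fun f => ?_
    simp only [Fin.snocEquiv, Equiv.coe_fn_mk, snoc_mem_iff, Fin.snoc_last,
      Fin.prod_univ_castSucc (n := k + 1), Fin.snoc_castSucc]
    by_cases hf : StrictMono f ∧ ∀ i, 0 < f i
    · simp only [hf, true_and, ← ENNReal.tsum_mul_left, mul_ite, mul_zero, mul_assoc]
      simp
    · simp [hf]

lemma mzvOnes_eq (k h : ℕ) :
    mzvOnes k h = (∑' n, chainSum (k + 1) n * recip n ^ h).toReal := by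
  rw [← tsum_strictMono_eq k (fun n => recip n ^ h), ENNReal.tsum_toReal_eq]
  · refine tsum_congr fun f => ?_
    rw [ENNReal.toReal_mul, ENNReal.toReal_prod, ENNReal.toReal_pow]
    simp [recip]
  · intro f
    exact ENNReal.mul_ne_top (ENNReal.prod_ne_top fun _ _ => ENNReal.ofReal_ne_top)
      (ENNReal.pow_ne_top ENNReal.ofReal_ne_top)

end MzvDuality

theorem stmt6 (h k : ℕ) (hh : 1 ≤ h) (hk : 1 ≤ k) :
    mzvOnes (k - 1) h = mzvOnes (h - 1) k := by
  obtain ⟨h, rfl⟩ := Nat.exists_eq_add_of_le' hh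
  obtain ⟨k, rfl⟩ := Nat.exists_eq_add_of_le' hk
  rw [MzvDuality.mzvOnes_eq, MzvDuality.mzvOnes_eq]
  exact congrArg ENNReal.toReal (MzvDuality.tsum_chainSum_duality k h)
end

section
/- For every integer k ≥ 2, Σ_{0 < n_1 < ⋯ < n_{k-1}} 1/(n_1 n_2 ⋯ n_{k-2} n_{k-1}^2) = ζ(k). -/
open Filter Topology

/-- The connector `m! n! / (m + n)!` of Seki and Yamamoto. -/
noncomputable def connector (m n : ℕ) : ℝ :=
  (m.factorial * n.factorial : ℝ) / (m + n).factorial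

lemma connector_nonneg (m n : ℕ) : 0 ≤ connector m n := by
  unfold connector; positivity

lemma connector_comm (m n : ℕ) : connector m n = connector n m := by
  rw [connector, connector, mul_comm, add_comm]

lemma connector_zero_right (m : ℕ) : connector m 0 = 1 := by
  have : (m.factorial : ℝ) ≠ 0 := by positivity
  simp [connector, this]

lemma connector_succ_div (m n : ℕ) :
    connector (m + 1) (n + 1) / (n + 1) =
      (connector (m + 1) n - connector (m + 1) (n + 1)) / (m + 1) := by
  have h : m + 1 + (n + 1) = (m + 1 + n) + 1 := by ring
  have h₁ : ((m + 1 + n).factorial : ℝ) ≠ 0 := by positivity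
  have h₂ : (m : ℝ) + 1 + n + 1 ≠ 0 := by positivity
  rw [connector, connector, h, Nat.factorial_succ (m + 1 + n), Nat.factorial_succ n]
  push_cast
  field_simp
  ring

lemma connector_succ_le (m n : ℕ) : connector (m + 1) n ≤ 1 / ((n : ℝ) + 1) := by
  induction m with
  | zero =>
    have : (n.factorial : ℝ) ≠ 0 := by positivity
    rw [connector, zero_add, add_comm 1 n, Nat.factorial_succ n]
    apply le_of_eq
    push_cast
    field_simp
    simp
  | succ m ih =>
    refine le_trans ?_ ih
    have h : m + 1 + 1 + n = (m + 1 + n) + 1 := by ring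
    rw [connector, connector, h, Nat.factorial_succ (m + 1 + n), Nat.factorial_succ (m + 1),
      div_le_div_iff₀ (by positivity) (by positivity)]
    push_cast
    have : (0 : ℝ) ≤ (m + 1).factorial * n.factorial * (m + 1 + n).factorial * n := by positivity
    nlinarith

lemma tendsto_connector (m : ℕ) : Tendsto (connector (m + 1)) atTop (𝓝 0) :=
  squeeze_zero (connector_nonneg _) (connector_succ_le m) tendsto_one_div_add_atTop_nhds_zero_nat

lemma hasSum_connector (m n : ℕ) :
    HasSum (fun d : ℕ => connector (m + 1) (n + d + 1) / ((n + d + 1 : ℕ) : ℝ))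
      (connector (m + 1) n / ((m + 1 : ℕ) : ℝ)) := by
  rw [hasSum_iff_tendsto_nat_of_nonneg
    fun d => div_nonneg (connector_nonneg _ _) (Nat.cast_nonneg _)]
  have h : ∀ N, ∑ d ∈ Finset.range N, connector (m + 1) (n + d + 1) / ((n + d + 1 : ℕ) : ℝ) =
      (connector (m + 1) n - connector (m + 1) (N + n)) / ((m + 1 : ℕ) : ℝ) := by
    intro N
    induction N with
    | zero => simp
    | succ N ih =>
      have := connector_succ_div m (n + N)
      rw [Finset.sum_range_succ, ih]
      push_cast at this ⊢
      rw [this, show N + 1 + n = n + N + 1 by ring, add_comm N n]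
      ring
  simp_rw [h]
  simpa using (((tendsto_connector m).comp (tendsto_add_atTop_nat n)).const_sub
    (connector (m + 1) n)).div_const ((m + 1 : ℕ) : ℝ)

lemma tsum_ofReal_connector (m n : ℕ) :
    ∑' d : ℕ, ENNReal.ofReal (connector (m + 1) (n + d + 1) / ((n + d + 1 : ℕ) : ℝ)) =
      ENNReal.ofReal (connector (m + 1) n / ((m + 1 : ℕ) : ℝ)) := by
  rw [← (hasSum_connector m n).tsum_eq, ENNReal.ofReal_tsum_of_nonneg
    (fun d => div_nonneg (connector_nonneg _ _) (Nat.cast_nonneg _)) (hasSum_connector m n).summable]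

/-- Strictly increasing `(k+1)`-tuples of positive integers. -/
abbrev PosChain (k : ℕ) : Type :=
  {f : Fin (k + 1) → ℕ // StrictMono f ∧ ∀ i, 0 < f i}

/-- A chain of length one is a positive integer. -/
def posChainZeroEquiv : PosChain 0 ≃ ℕ where
  toFun f := f.1 0 - 1
  invFun n := ⟨fun _ => n + 1, fun i j h => absurd h (by omega), fun _ => n.succ_pos⟩
  left_inv f := by
    ext i
    have := f.2.2 0
    obtain rfl : i = 0 := by omega
    simp only
    omega
  right_inv n := by simp

/-- A chain is its initial part together with the gap before its last entry. -/
def posChainSuccEquiv (k : ℕ) : PosChain (k + 1) ≃ PosChain k × ℕ where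
  toFun f := (⟨fun i => f.1 i.castSucc, f.2.1.comp (Fin.strictMono_castSucc),
      fun i => f.2.2 i.castSucc⟩,
    f.1 (Fin.last (k + 1)) - f.1 (Fin.last k).castSucc - 1)
  invFun p := ⟨Fin.snoc (α := fun _ => ℕ) p.1.1 (p.1.1 (Fin.last k) + p.2 + 1), by
      constructor
      · intro i j hij
        induction j using Fin.lastCases with
        | last =>
          induction i using Fin.lastCases with
          | last => exact absurd hij (lt_irrefl _)
          | cast i =>
            have := p.1.2.1.monotone (Fin.le_last i)
            simp only [Fin.snoc_castSucc, Fin.snoc_last]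
            omega
        | cast j =>
          induction i using Fin.lastCases with
          | last => exact absurd hij (not_lt.mpr (Fin.le_last _))
          | cast i =>
            simp only [Fin.snoc_castSucc]
            exact p.1.2.1 (Fin.castSucc_lt_castSucc_iff.mp hij)
      · intro i
        induction i using Fin.lastCases with
        | last => simp
        | cast i => simpa using p.1.2.2 i⟩
  left_inv f := by
    ext i
    induction i using Fin.lastCases with
    | last =>
      have := f.2.1 (Fin.castSucc_lt_last (Fin.last k))
      simp only [Fin.snoc_last]
      omega
    | cast i => simp
  right_inv p := by
    ext
    · simp
    · simp only [Fin.snoc_last, Fin.snoc_castSucc]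
      omega

lemma tsum_posChain_connector (k m : ℕ) :
    ∑' f : PosChain k, ENNReal.ofReal
        ((∏ i, (1 : ℝ) / (f.1 i : ℝ)) * connector (m + 1) (f.1 (Fin.last k))) =
      ENNReal.ofReal ((1 / ((m + 1 : ℕ) : ℝ)) ^ (k + 1)) := by
  induction k with
  | zero =>
    rw [← posChainZeroEquiv.symm.tsum_eq]
    have := tsum_ofReal_connector m 0
    simp only [connector_zero_right, zero_add] at this
    simpa [posChainZeroEquiv, div_eq_inv_mul] using this
  | succ k ih =>
    rw [← (posChainSuccEquiv k).symm.tsum_eq, ENNReal.summable.tsum_prod' fun _ => ENNReal.summable]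
    have h : ∀ g : PosChain k, ∑' d : ℕ, ENNReal.ofReal
        ((∏ i, (1 : ℝ) / (((posChainSuccEquiv k).symm (g, d)).1 i : ℝ)) *
          connector (m + 1) (((posChainSuccEquiv k).symm (g, d)).1 (Fin.last (k + 1)))) =
        ENNReal.ofReal
          ((∏ i, (1 : ℝ) / (g.1 i : ℝ)) * connector (m + 1) (g.1 (Fin.last k))) *
          ENNReal.ofReal (1 / ((m + 1 : ℕ) : ℝ)) := by
      intro g
      have hg : (0 : ℝ) ≤ ∏ i, (1 : ℝ) / (g.1 i : ℝ) :=
        Finset.prod_nonneg fun i _ => by positivity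
      rw [← ENNReal.ofReal_mul (mul_nonneg hg (connector_nonneg _ _)), mul_assoc, mul_one_div,
        ENNReal.ofReal_mul hg, ← tsum_ofReal_connector, ← ENNReal.tsum_mul_left]
      refine tsum_congr fun d => ?_
      rw [← ENNReal.ofReal_mul hg, Fin.prod_univ_castSucc]
      simp only [posChainSuccEquiv, Equiv.coe_fn_symm_mk, Fin.snoc_castSucc, Fin.snoc_last]
      congr 1
      ring
    simp_rw [h]
    rw [ENNReal.tsum_mul_right, ih, ← ENNReal.ofReal_mul (by positivity), ← pow_succ]

lemma tsum_ofReal_mzvOnes_one (k : ℕ) :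
    ∑' f : PosChain k, ENNReal.ofReal
        ((∏ i, (1 : ℝ) / (f.1 i : ℝ)) * (1 / (f.1 (Fin.last k) : ℝ)) ^ 1) =
      ∑' m : ℕ, ENNReal.ofReal (1 / ((m : ℝ) + 1) ^ (k + 2)) := by
  have hf : ∀ f : PosChain k, ENNReal.ofReal
      ((∏ i, (1 : ℝ) / (f.1 i : ℝ)) * (1 / (f.1 (Fin.last k) : ℝ)) ^ 1) =
      ∑' m : ℕ, ENNReal.ofReal
        ((∏ i, (1 : ℝ) / (f.1 i : ℝ)) * connector (m + 1) (f.1 (Fin.last k))) *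
        ENNReal.ofReal (1 / ((m + 1 : ℕ) : ℝ)) := by
    intro f
    have hp : (0 : ℝ) ≤ ∏ i, (1 : ℝ) / (f.1 i : ℝ) :=
      Finset.prod_nonneg fun i _ => by positivity
    obtain ⟨n, hn⟩ := Nat.exists_eq_succ_of_ne_zero (f.2.2 (Fin.last k)).ne'
    have := tsum_ofReal_connector n 0
    simp only [connector_zero_right, zero_add] at this
    rw [pow_one, ENNReal.ofReal_mul hp, hn, Nat.succ_eq_add_one, ← this, ← ENNReal.tsum_mul_left]
    refine tsum_congr fun m => ?_
    rw [← ENNReal.ofReal_mul hp, ← ENNReal.ofReal_mul (mul_nonneg hp (connector_nonneg _ _)),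
      connector_comm, mul_assoc, mul_one_div]
  simp_rw [hf]
  rw [ENNReal.tsum_comm]
  refine tsum_congr fun m => ?_
  rw [ENNReal.tsum_mul_right, tsum_posChain_connector, ← ENNReal.ofReal_mul (by positivity),
    ← pow_succ, one_div_pow]
  push_cast
  rfl

theorem stmt7 (k : ℕ) (hk : 2 ≤ k) :
    mzvOnes (k - 2) 1 = ∑' n : ℕ, 1 / ((n : ℝ) + 1) ^ k := by
  obtain ⟨k, rfl⟩ := Nat.exists_eq_add_of_le' hk
  rw [Nat.add_sub_cancel, mzvOnes]
  have h := congrArg ENNReal.toReal (tsum_ofReal_mzvOnes_one k)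
  rw [ENNReal.tsum_toReal_eq fun _ => ENNReal.ofReal_ne_top,
    ENNReal.tsum_toReal_eq fun _ => ENNReal.ofReal_ne_top] at h
  convert h using 3 with f n
  · exact (ENNReal.toReal_ofReal (mul_nonneg
      (Finset.prod_nonneg fun i _ => by positivity) (by positivity))).symm
  · exact (ENNReal.toReal_ofReal (by positivity)).symm
end

section
/- For every real θ > 0, every integer ℓ ≥ 1, and every real z with 0 ≤ z ≤ 1, the infinite product identity (ℓ/(ℓ+θ-θz)) · Π_{i=ℓ+1}^∞ [ i (i+2θ-θz) / ((i+θ)(i+θ-θz)) ] = Γ(ℓ+1+θ) Γ(ℓ+θ-θz) / (Γ(ℓ) Γ(ℓ+1+2θ-θz)) holds. -/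
theorem summable_one_div_add_mul_add {c d : ℝ} (hc : 0 < c) (hd : 0 < d) :
    Summable fun i : ℕ ↦ 1 / ((c + i) * (d + i)) := by
  rw [← summable_nat_add_iff 1]
  refine Summable.of_nonneg_of_le (fun i ↦ by positivity) (fun i ↦ ?_)
    ((summable_nat_add_iff 1).2 (Real.summable_one_div_nat_pow.2 one_lt_two))
  rw [sq]
  gcongr <;> linarith

theorem multipliable_mul_div_mul {a b c d : ℝ} (hc : 0 < c) (hd : 0 < d)
    (h : a + b = c + d) :
    Multipliable fun i : ℕ ↦ ((a + i) * (b + i)) / ((c + i) * (d + i)) := by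
  have hs := (summable_one_div_add_mul_add hc hd).mul_left (a * b - c * d)
  convert Real.multipliable_one_add_of_summable hs using 2 with i
  have hci : c + i ≠ 0 := by positivity
  have hdi : d + i ≠ 0 := by positivity
  field_simp
  linear_combination (i : ℝ) * h

/-- The Weierstrass-type evaluation of `∏ (a + i) (b + i) / ((c + i) (d + i))` for
`a + b = c + d` in terms of the Gamma function. -/
theorem hasProd_mul_div_mul_Gamma {a b c d : ℝ} (ha : 0 < a) (hb : 0 < b) (hc : 0 < c)
    (hd : 0 < d) (h : a + b = c + d) :
    HasProd (fun i : ℕ ↦ ((a + i) * (b + i)) / ((c + i) * (d + i)))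
      (Real.Gamma c * Real.Gamma d / (Real.Gamma a * Real.Gamma b)) := by
  rw [(multipliable_mul_div_mul hc hd h).hasProd_iff_tendsto_nat,
    ← Filter.tendsto_add_atTop_iff_nat 1]
  have hlim := ((Real.GammaSeq_tendsto_Gamma c).mul (Real.GammaSeq_tendsto_Gamma d)).div
    ((Real.GammaSeq_tendsto_Gamma a).mul (Real.GammaSeq_tendsto_Gamma b))
    (mul_pos (Real.Gamma_pos_of_pos ha) (Real.Gamma_pos_of_pos hb)).ne'
  refine hlim.congr' ?_
  filter_upwards [Filter.eventually_gt_atTop 0] with n hn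
  have hn' : (0 : ℝ) < n := Nat.cast_pos.2 hn
  have hprod {s : ℝ} (hs : 0 < s) : ∏ j ∈ Finset.range (n + 1), (s + j) ≠ 0 :=
    Finset.prod_ne_zero_iff.2 fun j _ ↦ by positivity
  have hpow : (n : ℝ) ^ a * (n : ℝ) ^ b = (n : ℝ) ^ c * (n : ℝ) ^ d := by
    rw [← Real.rpow_add hn', ← Real.rpow_add hn', h]
  have hpa := (Real.rpow_pos_of_pos hn' a).ne'
  have hpb := (Real.rpow_pos_of_pos hn' b).ne'
  have hfac : (n.factorial : ℝ) ≠ 0 := by positivity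
  have h1 := hprod ha
  have h2 := hprod hb
  have h3 := hprod hc
  have h4 := hprod hd
  simp only [Pi.div_apply, Real.GammaSeq, Finset.prod_div_distrib, Finset.prod_mul_distrib]
  generalize (n : ℝ) ^ a = A at *
  generalize (n : ℝ) ^ b = B at *
  generalize (n : ℝ) ^ c = C at *
  generalize (n : ℝ) ^ d = D at *
  field_simp
  exact hpow.symm

theorem stmt10 (θ : ℝ) (hθ : 0 < θ) (ℓ : ℕ) (hℓ : 1 ≤ ℓ) (z : ℝ)
    (hz0 : 0 ≤ z) (hz1 : z ≤ 1) :
    ((ℓ : ℝ) / ((ℓ : ℝ) + θ - θ * z)) *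
        ∏' i : ℕ,
          (((ℓ : ℝ) + 1 + i) * ((ℓ : ℝ) + 1 + i + 2 * θ - θ * z)) /
            ((((ℓ : ℝ) + 1 + i) + θ) * (((ℓ : ℝ) + 1 + i) + θ - θ * z)) =
      Real.Gamma ((ℓ : ℝ) + 1 + θ) * Real.Gamma ((ℓ : ℝ) + θ - θ * z) /
        (Real.Gamma (ℓ : ℝ) * Real.Gamma ((ℓ : ℝ) + 1 + 2 * θ - θ * z)) := by
  have hl : (0 : ℝ) < ℓ := Nat.cast_pos.2 hℓ
  have hθz : θ * z ≤ θ := mul_le_of_le_one_right hθ.le hz1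
  have hd : 0 < (ℓ : ℝ) + θ - θ * z := by linarith
  have hb : 0 < (ℓ : ℝ) + 1 + 2 * θ - θ * z := by linarith
  have key := (hasProd_mul_div_mul_Gamma (a := ℓ + 1) (b := ℓ + 1 + 2 * θ - θ * z)
    (c := ℓ + 1 + θ) (d := ℓ + θ - θ * z + 1) (by linarith) hb (by linarith) (by linarith)
    (by ring)).tprod_eq
  rw [Real.Gamma_add_one hl.ne', Real.Gamma_add_one hd.ne'] at key
  have hterm (i : ℕ) :
      (((ℓ : ℝ) + 1 + i) * ((ℓ : ℝ) + 1 + i + 2 * θ - θ * z)) /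
          ((((ℓ : ℝ) + 1 + i) + θ) * (((ℓ : ℝ) + 1 + i) + θ - θ * z)) =
        ((ℓ + 1 + i) * (ℓ + 1 + 2 * θ - θ * z + i)) /
          ((ℓ + 1 + θ + i) * (ℓ + θ - θ * z + 1 + i)) := by
    congr 1 <;> ring
  rw [tprod_congr hterm, key]
  have hGl := (Real.Gamma_pos_of_pos hl).ne'
  have hGb := (Real.Gamma_pos_of_pos hb).ne'
  have hd' := hd.ne'
  generalize Real.Gamma ((ℓ : ℝ) + 1 + 2 * θ - θ * z) = G at *
  generalize Real.Gamma ((ℓ : ℝ) + θ - θ * z) = G' at *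
  generalize (ℓ : ℝ) + θ - θ * z = y at *
  field_simp
end

section
/- The sequence u_k is strictly decreasing in k and converges to 1/q(1) = 1/(a+b+c) as k → ∞. -/
theorem summable_inv_quadratic {a : ℝ} (ha : 0 < a) (b c : ℝ) :
    Summable fun n : ℕ ↦ 1 / (a * ((n : ℝ) + 1) ^ 2 + b * ((n : ℝ) + 1) + c) := by
  have hs : Summable fun n : ℕ ↦ 2 / a * (1 / ((n : ℝ) + 1) ^ 2) := by
    have h := (summable_nat_add_iff 1).2
      (Real.summable_one_div_nat_pow.2 (by norm_num : 1 < 2))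
    simpa using h.mul_left (2 / a)
  refine Summable.of_norm_bounded_eventually_nat hs ?_
  filter_upwards [Filter.eventually_ge_atTop ⌈2 * (|b| + |c|) / a⌉₊] with n hn
  have hx : 2 * (|b| + |c|) / a ≤ (n : ℝ) := Nat.ceil_le.1 hn
  have hn0 : (0 : ℝ) ≤ n := n.cast_nonneg
  rw [div_le_iff₀ ha] at hx
  generalize (n : ℝ) = x at hx hn0
  have hb := neg_abs_le b
  have hc := neg_abs_le c
  have key : a / 2 * (x + 1) ^ 2 ≤ a * (x + 1) ^ 2 + b * (x + 1) + c := by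
    have h₁ : (|b| + |c|) * (x + 1) ≤ a / 2 * (x + 1) * (x + 1) :=
      mul_le_mul_of_nonneg_right (by linarith) (by linarith)
    have h₂ := mul_nonneg (abs_nonneg c) hn0
    have h₃ : -|b| * (x + 1) ≤ b * (x + 1) :=
      mul_le_mul_of_nonneg_right hb (by linarith)
    linarith
  have hpos : 0 < a / 2 * (x + 1) ^ 2 := by positivity
  rw [Real.norm_of_nonneg (one_div_nonneg.2 (hpos.le.trans key))]
  calc 1 / (a * (x + 1) ^ 2 + b * (x + 1) + c) ≤ 1 / (a / 2 * (x + 1) ^ 2) :=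
        one_div_le_one_div_of_le hpos key
    _ = 2 / a * (1 / (x + 1) ^ 2) := by field_simp

theorem stmt14 (a b c : ℝ) (ha : 0 < a)
    (hq : ∀ n : ℕ, 1 ≤ n → 0 < a * (n : ℝ) ^ 2 + b * n + c)
    (u : ℕ → ℝ)
    (hu : ∀ k : ℕ, u k = ∑' n : ℕ,
      ((n : ℝ) + 1) ^ (-(k : ℤ)) / (a * ((n : ℝ) + 1) ^ 2 + b * ((n : ℝ) + 1) + c)) :
    StrictAnti u ∧ Filter.Tendsto u Filter.atTop (nhds (1 / (a + b + c))) := by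
  have hpos (n : ℕ) : 0 < a * ((n : ℝ) + 1) ^ 2 + b * ((n : ℝ) + 1) + c := by
    simpa using hq (n + 1) n.succ_pos
  have hpow (k n : ℕ) : ((n : ℝ) + 1) ^ (-(k : ℤ)) = (((n : ℝ) + 1)⁻¹) ^ k := by
    simp
  simp only [hpow] at hu
  have hinv0 (n : ℕ) : 0 < ((n : ℝ) + 1)⁻¹ := by positivity
  have hinv1 (n : ℕ) : ((n : ℝ) + 1)⁻¹ ≤ 1 := inv_le_one_of_one_le₀ (by simp)
  have hsum := summable_inv_quadratic ha b c
  have hbound (k n : ℕ) :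
      ‖(((n : ℝ) + 1)⁻¹) ^ k / (a * ((n : ℝ) + 1) ^ 2 + b * ((n : ℝ) + 1) + c)‖ ≤
        1 / (a * ((n : ℝ) + 1) ^ 2 + b * ((n : ℝ) + 1) + c) := by
    rw [Real.norm_of_nonneg (div_nonneg (pow_nonneg (hinv0 n).le k) (hpos n).le)]
    exact div_le_div_of_nonneg_right (pow_le_one₀ (hinv0 n).le (hinv1 n)) (hpos n).le
  have hsumk (k : ℕ) := Summable.of_norm_bounded hsum (hbound k)
  constructor
  · refine strictAnti_nat_of_succ_lt fun k ↦ ?_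
    rw [hu, hu]
    refine Summable.tsum_lt_tsum (i := 1) (fun n ↦ ?_) ?_ (hsumk _) (hsumk _)
    · exact div_le_div_of_nonneg_right
        (pow_le_pow_of_le_one (hinv0 n).le (hinv1 n) k.le_succ) (hpos n).le
    · exact div_lt_div_of_pos_right
        (pow_lt_pow_right_of_lt_one₀ (hinv0 1) (by norm_num) k.lt_succ_self) (hpos 1)
  · rw [funext hu, ← tsum_ite_eq 0 fun _ : ℕ ↦ 1 / (a + b + c)]
    refine tendsto_tsum_of_dominated_convergence hsum (fun n ↦ ?_)
      (Filter.Eventually.of_forall hbound)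
    rcases eq_or_ne n 0 with rfl | hn
    · simp
    · have hlt : ((n : ℝ) + 1)⁻¹ < 1 :=
        inv_lt_one_of_one_lt₀ (by simpa using Nat.pos_of_ne_zero hn)
      simpa [hn] using (tendsto_pow_atTop_nhds_zero_of_lt_one (hinv0 n).le hlt).div_const
        (a * ((n : ℝ) + 1) ^ 2 + b * ((n : ℝ) + 1) + c)
end

section
/- For every real z with |z| < 1, (a z² + b z + c) · Σ_{k=0}^∞ u_k z^k = c u_0 + (b u_0 + c u_1) z + Σ_{n=2}^∞ ζ(n) z^n. -/
/-- The reciprocals of a quadratic with positive leading coefficient are summable. -/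
theorem summable_one_div_quadratic (a b c : ℝ) (ha : 0 < a) :
    Summable fun n : ℕ => 1 / (a * ((n : ℝ) + 1) ^ 2 + b * ((n : ℝ) + 1) + c) := by
  have hs : Summable fun n : ℕ => (2 / a) * (1 / ((n : ℝ) + 1) ^ 2) := by
    apply Summable.mul_left
    have h := (summable_nat_add_iff 1).2 (Real.summable_one_div_nat_pow.2 one_lt_two)
    simpa using h
  refine hs.of_norm_bounded_eventually_nat ?_
  obtain ⟨N, hN⟩ := exists_nat_ge (2 * (|b| + |c|) / a)
  filter_upwards [Filter.eventually_ge_atTop N] with n hn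
  have hn0 : (0 : ℝ) ≤ n := Nat.cast_nonneg n
  have hnN : (N : ℝ) ≤ n := by exact_mod_cast hn
  have hx : (1 : ℝ) ≤ (n : ℝ) + 1 := by linarith
  have hxN : 2 * (|b| + |c|) / a ≤ (n : ℝ) + 1 := by linarith
  generalize (n : ℝ) + 1 = x at hx hxN ⊢
  rw [div_le_iff₀ ha] at hxN
  have hb : -(|b| * x) ≤ b * x := by nlinarith [neg_abs_le b]
  have hc : -(|c| * x) ≤ c := by nlinarith [neg_abs_le c, abs_nonneg c]
  have hbc : 2 * (|b| + |c|) * x ≤ x * a * x := by gcongr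
  have hlow : a / 2 * x ^ 2 ≤ a * x ^ 2 + b * x + c := by nlinarith
  have hpos : 0 < a / 2 * x ^ 2 := by positivity
  rw [Real.norm_of_nonneg (one_div_nonneg.2 (hpos.le.trans hlow))]
  calc 1 / (a * x ^ 2 + b * x + c) ≤ 1 / (a / 2 * x ^ 2) :=
        one_div_le_one_div_of_le hpos hlow
    _ = 2 / a * (1 / x ^ 2) := by field_simp

/-- A bounded sequence gives a power series converging on the open unit disc. -/
theorem summable_mul_pow_of_bounded {u : ℕ → ℝ} {C z : ℝ} (hu : ∀ k, |u k| ≤ C)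
    (hz : |z| < 1) : Summable fun k : ℕ => u k * z ^ k := by
  refine ((summable_geometric_of_lt_one (abs_nonneg z) hz).mul_left C).of_norm_bounded ?_
  intro k
  rw [Real.norm_eq_abs, abs_mul, abs_pow]
  gcongr
  exact hu k

/-- Multiplying a convergent power series by a quadratic polynomial. -/
theorem quadratic_mul_tsum_mul_pow {u : ℕ → ℝ} {z : ℝ} (a b c : ℝ)
    (hs : Summable fun k : ℕ => u k * z ^ k) :
    (a * z ^ 2 + b * z + c) * ∑' k : ℕ, u k * z ^ k =
      c * u 0 + (b * u 0 + c * u 1) * z +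
        ∑' k : ℕ, (a * u k + b * u (k + 1) + c * u (k + 2)) * z ^ (k + 2) := by
  have hs1 : Summable fun k : ℕ => u (k + 1) * z ^ (k + 1) := (summable_nat_add_iff 1).2 hs
  have hs2 : Summable fun k : ℕ => u (k + 2) * z ^ (k + 2) := (summable_nat_add_iff 2).2 hs
  have h1 : u 0 + ∑' k : ℕ, u (k + 1) * z ^ (k + 1) = ∑' k : ℕ, u k * z ^ k := by
    simpa using hs.sum_add_tsum_nat_add 1
  have h2 : u 0 + u 1 * z + ∑' k : ℕ, u (k + 2) * z ^ (k + 2) = ∑' k : ℕ, u k * z ^ k := by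
    simpa [Finset.sum_range_succ] using hs.sum_add_tsum_nat_add 2
  have h : ∑' k : ℕ, (a * u k + b * u (k + 1) + c * u (k + 2)) * z ^ (k + 2) =
      a * z ^ 2 * ∑' k : ℕ, u k * z ^ k + b * z * ∑' k : ℕ, u (k + 1) * z ^ (k + 1) +
        c * ∑' k : ℕ, u (k + 2) * z ^ (k + 2) := by
    rw [← tsum_mul_left, ← tsum_mul_left, ← tsum_mul_left,
      ← (hs.mul_left _).tsum_add (hs1.mul_left _),
      ← ((hs.mul_left _).add (hs1.mul_left _)).tsum_add (hs2.mul_left _)]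
    exact tsum_congr fun k => by ring
  rw [h]
  linear_combination -(b * z) * h1 - c * h2

theorem stmt15 (a b c : ℝ) (ha : 0 < a)
    (hq : ∀ n : ℕ, 1 ≤ n → 0 < a * (n : ℝ) ^ 2 + b * n + c)
    (u : ℕ → ℝ)
    (hu : ∀ k : ℕ, u k = ∑' n : ℕ,
      ((n : ℝ) + 1) ^ (-(k : ℤ)) / (a * ((n : ℝ) + 1) ^ 2 + b * ((n : ℝ) + 1) + c))
    (z : ℝ) (hz : |z| < 1) :
    (a * z ^ 2 + b * z + c) * ∑' k : ℕ, u k * z ^ k =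
      c * u 0 + (b * u 0 + c * u 1) * z + ∑' n : ℕ, zeta (n + 2) * z ^ (n + 2) := by
  have hqpos : ∀ n : ℕ, 0 < a * ((n : ℝ) + 1) ^ 2 + b * ((n : ℝ) + 1) + c := fun n => by
    simpa using hq (n + 1) (Nat.le_add_left 1 n)
  have hx : ∀ n : ℕ, (1 : ℝ) ≤ (n : ℝ) + 1 := fun n => by simp
  have hnonneg : ∀ k n : ℕ, 0 ≤ ((n : ℝ) + 1) ^ (-(k : ℤ)) /
      (a * ((n : ℝ) + 1) ^ 2 + b * ((n : ℝ) + 1) + c) := fun k n =>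
    div_nonneg (by positivity) (hqpos n).le
  have hle : ∀ k n : ℕ, ((n : ℝ) + 1) ^ (-(k : ℤ)) /
      (a * ((n : ℝ) + 1) ^ 2 + b * ((n : ℝ) + 1) + c) ≤
      1 / (a * ((n : ℝ) + 1) ^ 2 + b * ((n : ℝ) + 1) + c) := fun k n =>
    div_le_div_of_nonneg_right (zpow_le_one_of_nonpos₀ (hx n) (by simp)) (hqpos n).le
  have hsum := summable_one_div_quadratic a b c ha
  have hsumk : ∀ k : ℕ, Summable fun n : ℕ => ((n : ℝ) + 1) ^ (-(k : ℤ)) /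
      (a * ((n : ℝ) + 1) ^ 2 + b * ((n : ℝ) + 1) + c) := fun k =>
    Summable.of_nonneg_of_le (hnonneg k) (hle k) hsum
  have hbound : ∀ k, |u k| ≤
      ∑' n : ℕ, 1 / (a * ((n : ℝ) + 1) ^ 2 + b * ((n : ℝ) + 1) + c) := fun k => by
    rw [hu k, abs_of_nonneg (tsum_nonneg (hnonneg k))]
    exact (hsumk k).tsum_le_tsum (hle k) hsum
  have hrec : ∀ k, a * u k + b * u (k + 1) + c * u (k + 2) = zeta (k + 2) := fun k => by
    rw [hu k, hu (k + 1), hu (k + 2), zeta, ← tsum_mul_left, ← tsum_mul_left, ← tsum_mul_left,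
      ← ((hsumk k).mul_left a).tsum_add ((hsumk (k + 1)).mul_left b),
      ← (((hsumk k).mul_left a).add ((hsumk (k + 1)).mul_left b)).tsum_add
        ((hsumk (k + 2)).mul_left c)]
    refine tsum_congr fun n => ?_
    have hqn := (hqpos n).ne'
    have hxn : (n : ℝ) + 1 ≠ 0 := by positivity
    simp only [zpow_neg, zpow_natCast]
    generalize (n : ℝ) + 1 = x at hqn hxn ⊢
    generalize hQ : a * x ^ 2 + b * x + c = Q at hqn ⊢
    field_simp
    rw [← hQ]
    ring
  rw [quadratic_mul_tsum_mul_pow a b c (summable_mul_pow_of_bounded hbound hz)]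
  simp only [hrec]
end

section
/- For every integer k ≥ 1, Σ_{n=1}^∞ 1/(n(n+1)(n+2)^k) = k/2^{k+1} - k + 1 + Σ_{j=2}^k ((2^{k+1-j} - 1)/2^{k+1-j}) ζ(j). -/
theorem HasSum.congr_of_eq {f g : ℕ → ℝ} {a b : ℝ} (h : HasSum f a)
    (hfg : ∀ n, g n = f n) (hab : b = a) : HasSum g b := by
  obtain rfl : g = f := funext hfg
  exact hab ▸ h

theorem hasSum_zeta_shift_two {k : ℕ} (hk : 2 ≤ k) :
    HasSum (fun n : ℕ => 1 / ((n : ℝ) + 3) ^ k) (zeta k - 1 - 1 / 2 ^ k) := by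
  have hs : Summable (fun n : ℕ => 1 / ((n : ℝ) + 1) ^ k) := by
    have h := (summable_nat_add_iff 1).mpr
      (Real.summable_one_div_nat_pow.mpr (show 1 < k by omega))
    simpa using h
  have h : HasSum (fun n : ℕ => 1 / ((n : ℝ) + 1) ^ k) (zeta k) := hs.hasSum
  have h2 := (hasSum_nat_add_iff' 2).mpr h
  refine h2.congr_of_eq (fun n => ?_) ?_
  · push_cast
    ring_nf
  · norm_num [Finset.sum_range_succ]
    ring

theorem hasSum_one_div_mul_succ :
    HasSum (fun n : ℕ => 1 / (((n : ℝ) + 1) * ((n : ℝ) + 2))) 1 := by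
  rw [hasSum_iff_tendsto_nat_of_nonneg (fun n => by positivity)]
  have hsum (N : ℕ) : ∑ n ∈ Finset.range N, 1 / (((n : ℝ) + 1) * ((n : ℝ) + 2)) =
      1 - 1 / ((N : ℝ) + 1) := by
    induction N with
    | zero => simp
    | succ N ih =>
      rw [Finset.sum_range_succ, ih]
      push_cast
      field_simp
      ring
  simp only [hsum]
  simpa using (tendsto_one_div_add_atTop_nhds_zero_nat (𝕜 := ℝ)).const_sub 1

theorem hasSum_one_div_mul_pow (k : ℕ) :
    HasSum (fun n : ℕ => 1 / (((n : ℝ) + 2) * ((n : ℝ) + 3) ^ (k + 1)))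
      (k + 1 - 1 / 2 ^ (k + 1) - ∑ j ∈ Finset.Icc 2 (k + 1), zeta j) := by
  induction k with
  | zero =>
    have h := (hasSum_nat_add_iff' 1).mpr hasSum_one_div_mul_succ
    refine h.congr_of_eq (fun n => ?_) ?_
    · push_cast
      ring_nf
    · norm_num
  | succ k ih =>
    refine HasSum.congr_of_eq (ih.sub (hasSum_zeta_shift_two (show 2 ≤ k + 1 + 1 by omega)))
      (fun n => ?_) ?_
    · field_simp
      ring
    · rw [Finset.sum_Icc_succ_top (by omega)]
      push_cast
      field_simp
      ring

theorem hasSum_one_div_mul_mul_pow (k : ℕ) :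
    HasSum (fun n : ℕ => 1 / (((n : ℝ) + 1) * ((n : ℝ) + 2) * ((n : ℝ) + 3) ^ k))
      (k / 2 ^ (k + 1) - k + 1 +
        ∑ j ∈ Finset.Icc 2 k, ((2 ^ (k + 1 - j) - 1) / 2 ^ (k + 1 - j)) * zeta j) := by
  induction k with
  | zero => simpa using hasSum_one_div_mul_succ
  | succ k ih =>
    refine HasSum.congr_of_eq ((ih.sub (hasSum_one_div_mul_pow k)).mul_left (1 / 2))
      (fun n => ?_) ?_
    · field_simp
      ring
    · have hcoeff : ∑ j ∈ Finset.Icc 2 (k + 1),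
            ((2 ^ (k + 1 + 1 - j) - 1) / 2 ^ (k + 1 + 1 - j) : ℝ) * zeta j =
          1 / 2 * (∑ j ∈ Finset.Icc 2 (k + 1),
            ((2 ^ (k + 1 - j) - 1) / 2 ^ (k + 1 - j)) * zeta j +
            ∑ j ∈ Finset.Icc 2 (k + 1), zeta j) := by
        rw [← Finset.sum_add_distrib, Finset.mul_sum]
        refine Finset.sum_congr rfl fun j hj => ?_
        rw [Finset.mem_Icc] at hj
        rw [show k + 1 + 1 - j = k + 1 - j + 1 by omega, pow_succ]
        field_simp
        ring
      have htop : ∑ j ∈ Finset.Icc 2 (k + 1),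
            ((2 ^ (k + 1 - j) - 1) / 2 ^ (k + 1 - j) : ℝ) * zeta j =
          ∑ j ∈ Finset.Icc 2 k, ((2 ^ (k + 1 - j) - 1) / 2 ^ (k + 1 - j)) * zeta j := by
        rcases k with _ | k
        · simp
        · rw [Finset.sum_Icc_succ_top (by omega)]
          simp
      rw [hcoeff, htop]
      push_cast
      field_simp
      ring

theorem stmt18 (k : ℕ) (hk : 1 ≤ k) :
    ∑' n : ℕ, 1 / (((n : ℝ) + 1) * ((n : ℝ) + 2) * ((n : ℝ) + 3) ^ k) =
      k / 2 ^ (k + 1) - k + 1 +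
        ∑ j ∈ Finset.Icc 2 k, ((2 ^ (k + 1 - j) - 1) / 2 ^ (k + 1 - j)) * zeta j :=
  (hasSum_one_div_mul_mul_pow k).tsum_eq
end

section
/- For every real θ > 0 and every integer n ≥ 3, Σ_{h=2}^{n-2} (h-1) · θ (h-1)! / (1+θ)_{h+1} = [ 1/(1+θ) - (n-1)!/(1+θ)_{n-1} - (n-2) θ (n-2)!/(1+θ)_{n-1} ] · (1/(1+θ)). -/
/-- The rising factorial `(x)_j = x (x+1) ⋯ (x+j-1)`, with `(x)_0 = 1`. -/
noncomputable def risingFactorial (x : ℝ) (j : ℕ) : ℝ := ∏ i ∈ Finset.range j, (x + i)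

lemma risingFactorial_succ (x : ℝ) (j : ℕ) :
    risingFactorial x (j + 1) = risingFactorial x j * (x + j) :=
  Finset.prod_range_succ _ _

lemma risingFactorial_pos {x : ℝ} (hx : 0 < x) (j : ℕ) : 0 < risingFactorial x j :=
  Finset.prod_pos fun _ _ => by positivity

theorem stmt19 (θ : ℝ) (hθ : 0 < θ) (n : ℕ) (hn : 3 ≤ n) :
    ∑ h ∈ Finset.Icc 2 (n - 2),
        ((h : ℝ) - 1) * θ * (Nat.factorial (h - 1) : ℝ) / risingFactorial (1 + θ) (h + 1) =
      (1 / (1 + θ) - (Nat.factorial (n - 1) : ℝ) / risingFactorial (1 + θ) (n - 1) -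
          ((n : ℝ) - 2) * θ * (Nat.factorial (n - 2) : ℝ) / risingFactorial (1 + θ) (n - 1)) *
        (1 / (1 + θ)) := by
  obtain ⟨m, rfl⟩ := Nat.exists_eq_add_of_le' hn
  have e1 (k : ℕ) : k + 3 - 1 = k + 2 := rfl
  have e2 (k : ℕ) : k + 3 - 2 = k + 1 := rfl
  rw [e1, e2]
  clear hn
  induction m with
  | zero =>
    rw [Finset.Icc_eq_empty (by norm_num), Finset.sum_empty]
    simp only [risingFactorial, Finset.prod_range_succ, Finset.prod_range_zero, Nat.factorial]
    push_cast
    field_simp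
    ring
  | succ m ih =>
    have hR := risingFactorial_pos (show 0 < 1 + θ by positivity) (m + 2)
    have hm : 0 < 1 + θ + ((m : ℝ) + 2) := by positivity
    rw [Finset.sum_Icc_succ_top (by omega), ih, show m + 1 + 1 - 1 = m + 1 from rfl,
      show m + 1 + 1 + 1 = m + 2 + 1 from rfl, show m + 1 + 2 = m + 2 + 1 from rfl,
      risingFactorial_succ _ (m + 2), Nat.factorial_succ (m + 2), Nat.factorial_succ (m + 1)]
    push_cast
    field_simp
    ring
end
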